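/- arXiv:1608.08604 — 4 statements merged into one kernel-verified Lean document; each statement's English description precedes it below -/
import Mathlib

section
/- Let n ≥ 2 be even. Define, for 1 ≤ j ≤ n, ρ̂(j) = j(n+1−j) and ψ̂(j) = j(n+1−j) − min(j, n+1−j)/2. Then min_{1≤j≤n} ψ̂(j)/ρ̂(j) = (n+1)/(n+2), and the minimum is attained at j = n/2 and at j = n/2 + 1. -/
/-- For even `n ≥ 2`, with `ρ̂(j) = j(n+1−j)` and
`ψ̂(j) = j(n+1−j) − min(j, n+1−j)/2`, one has `min_{1≤j≤n} ψ̂(j)/ρ̂(j) = (n+1)/(n+2)`,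
and the minimum is attained at `j = n/2` and at `j = n/2 + 1`. -/
theorem stmt_8 (n : ℕ) (hn : 2 ≤ n) (heven : Even n)
    (hne : (Finset.Icc 1 n).Nonempty)
    (ρ ψ : ℕ → ℝ)
    (hρ : ∀ j, ρ j = (j : ℝ) * ((n : ℝ) + 1 - (j : ℝ)))
    (hψ : ∀ j, ψ j = (j : ℝ) * ((n : ℝ) + 1 - (j : ℝ)) - min (j : ℝ) ((n : ℝ) + 1 - (j : ℝ)) / 2) :
    (Finset.Icc 1 n).inf' hne (fun j => ψ j / ρ j) = ((n : ℝ) + 1) / ((n : ℝ) + 2) ∧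
      ψ (n / 2) / ρ (n / 2) = ((n : ℝ) + 1) / ((n : ℝ) + 2) ∧
      ψ (n / 2 + 1) / ρ (n / 2 + 1) = ((n : ℝ) + 1) / ((n : ℝ) + 2) := by
  obtain ⟨m, rfl⟩ := heven
  have hm : (1 : ℝ) ≤ m := by exact_mod_cast (by omega : 1 ≤ m)
  have half : (m + m) / 2 = m := by omega
  have left : ψ m / ρ m = (((m + m : ℕ) : ℝ) + 1) / (((m + m : ℕ) : ℝ) + 2) := by
    rw [hρ, hψ]
    push_cast
    rw [min_eq_left (by linarith), div_eq_div_iff (by nlinarith) (by linarith)]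
    ring
  have right : ψ (m + 1) / ρ (m + 1) = (((m + m : ℕ) : ℝ) + 1) / (((m + m : ℕ) : ℝ) + 2) := by
    rw [hρ, hψ]
    push_cast
    rw [min_eq_right (by linarith), div_eq_div_iff (by nlinarith) (by linarith)]
    ring
  rw [half]
  refine ⟨le_antisymm ?_ ?_, left, right⟩
  · rw [← left]
    exact Finset.inf'_le (fun j => ψ j / ρ j) (Finset.mem_Icc.2 ⟨by omega, by omega⟩)
  · refine Finset.le_inf' _ _ fun j hj => ?_
    obtain ⟨hj₁, hj₂⟩ := Finset.mem_Icc.1 hj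
    have hj₁' : (1 : ℝ) ≤ j := by exact_mod_cast hj₁
    have hj₂' : (j : ℝ) ≤ m + m := by exact_mod_cast hj₂
    simp only [hρ, hψ]
    push_cast
    rw [div_le_div_iff₀ (by linarith) (mul_pos (by linarith) (by linarith))]
    rcases le_or_gt j m with h | h
    · have h' : (j : ℝ) ≤ m := by exact_mod_cast h
      rw [min_eq_left (by linarith)]
      nlinarith [mul_nonneg (by linarith : (0 : ℝ) ≤ j) (sub_nonneg.2 h')]
    · have h' : (m : ℝ) + 1 ≤ j := by exact_mod_cast h
      rw [min_eq_right (by linarith)]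
      nlinarith [mul_nonneg (by linarith : (0 : ℝ) ≤ m + m + 1 - j) (sub_nonneg.2 h')]
end

section
/- Let n ≥ 3 be odd, let i be an integer with 1 ≤ i ≤ ⌊(n+1)/4⌋, and set s = (n+1)/2. Define, for 1 ≤ j ≤ n, μ(j) = min(i, j, n+1−j), ρ̂(j) = j(n+1−j), and ψ̂(j) = j(n+1−j) − min(j, n+1−j)/2. Then for all 1 ≤ j ≤ n: μ(s)/ρ̂(s) ≤ μ(j)/ρ̂(j) and μ(s)/ψ̂(s) ≤ μ(j)/ψ̂(j). (That is, s is a minimizing index for both families of ratios.) -/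
/-- Among `1 ≤ m ≤ s` with `m = s` or `m + 1 ≤ s`, the ratio `min i m / (m (2s - m) - c m)` is
smallest at `m = s`, provided `2 i ≤ s` and `c ≤ 1 / 2`. -/
theorem min_div_le_min_div {i m s c : ℝ} (hi : 0 ≤ i) (his : 2 * i ≤ s) (hm : 1 ≤ m)
    (hms : m = s ∨ m + 1 ≤ s) (hc : c ≤ 1 / 2) :
    i / (s * s - c * s) ≤ min i m / (m * (2 * s - m) - c * m) := by
  have hle : m ≤ s := by rcases hms with h | h <;> linarith
  have hs : 0 < s * s - c * s := by nlinarith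
  have hd : 0 < m * (2 * s - m) - c * m := by
    have : 0 < m * (2 * s - m - c) := mul_pos (by linarith) (by linarith)
    linarith
  rw [div_le_div_iff₀ hs hd]
  rcases le_total i m with him | hmi
  · rw [min_eq_left him]
    refine mul_le_mul_of_nonneg_left ?_ hi
    rcases hms with rfl | h
    · linarith
    · nlinarith [mul_nonneg (sub_nonneg.2 hle) (by linarith : 0 ≤ s - m - c)]
  · rw [min_eq_right hmi]
    have key : i * (2 * s - m - c) ≤ s * s - c * s := by
      nlinarith [mul_nonneg (sub_nonneg.2 his) (by linarith : 0 ≤ 2 * s - m - c)]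
    nlinarith [mul_le_mul_of_nonneg_left key (by linarith : 0 ≤ m)]

/-- For odd `n ≥ 3` and `1 ≤ i ≤ ⌊(n+1)/4⌋`, with `s = (n+1)/2`,
`μ(j) = min(i, j, n+1−j)`, `ρ̂(j) = j(n+1−j)`, `ψ̂(j) = j(n+1−j) − min(j, n+1−j)/2`,
the index `s` minimizes both `μ(j)/ρ̂(j)` and `μ(j)/ψ̂(j)` over `1 ≤ j ≤ n`. -/
theorem stmt_9 (n i : ℕ) (hn : 3 ≤ n) (hodd : Odd n)
    (hi1 : 1 ≤ i) (hi2 : i ≤ (n + 1) / 4)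
    (s : ℕ) (hs : s = (n + 1) / 2)
    (μ ρ ψ : ℕ → ℝ)
    (hμ : ∀ j, μ j = min (i : ℝ) (min (j : ℝ) ((n : ℝ) + 1 - (j : ℝ))))
    (hρ : ∀ j, ρ j = (j : ℝ) * ((n : ℝ) + 1 - (j : ℝ)))
    (hψ : ∀ j, ψ j = (j : ℝ) * ((n : ℝ) + 1 - (j : ℝ)) - min (j : ℝ) ((n : ℝ) + 1 - (j : ℝ)) / 2) :
    ∀ j ∈ Finset.Icc 1 n, μ s / ρ s ≤ μ j / ρ j ∧ μ s / ψ s ≤ μ j / ψ j := by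
  intro j hj
  rw [Finset.mem_Icc] at hj
  obtain ⟨k, rfl⟩ := hodd
  obtain rfl : s = k + 1 := by omega
  have his : 2 * (i : ℝ) ≤ ((k + 1 : ℕ) : ℝ) := by exact_mod_cast (by omega : 2 * i ≤ k + 1)
  have hi : (0 : ℝ) ≤ i := i.cast_nonneg
  have hn1 : ((2 * k + 1 : ℕ) : ℝ) + 1 = 2 * ((k + 1 : ℕ) : ℝ) := by push_cast; ring
  obtain ⟨m, hm, hms, hmin, hprod⟩ : ∃ m : ℝ, 1 ≤ m ∧
      (m = ((k + 1 : ℕ) : ℝ) ∨ m + 1 ≤ ((k + 1 : ℕ) : ℝ)) ∧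
      min (j : ℝ) (2 * ((k + 1 : ℕ) : ℝ) - j) = m ∧
      (j : ℝ) * (2 * ((k + 1 : ℕ) : ℝ) - j) = m * (2 * ((k + 1 : ℕ) : ℝ) - m) := by
    rcases le_total j (k + 1) with h | h
    · have h' : (j : ℝ) ≤ ((k + 1 : ℕ) : ℝ) := by exact_mod_cast h
      refine ⟨j, by exact_mod_cast hj.1, ?_, min_eq_left (by linarith), rfl⟩
      exact_mod_cast (by omega : j = k + 1 ∨ j + 1 ≤ k + 1)
    · have h' : ((k + 1 : ℕ) : ℝ) ≤ j := by exact_mod_cast h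
      have hjn : (j : ℝ) + 1 ≤ 2 * ((k + 1 : ℕ) : ℝ) := by
        exact_mod_cast (by omega : j + 1 ≤ 2 * (k + 1))
      refine ⟨2 * ((k + 1 : ℕ) : ℝ) - j, by linarith, ?_, min_eq_right (by linarith), by ring⟩
      rcases h.eq_or_lt with h | h
      · left
        rw [← h]
        ring
      · right
        have : ((k + 1 : ℕ) : ℝ) + 1 ≤ j := by exact_mod_cast h
        linarith
  have hss : 2 * ((k + 1 : ℕ) : ℝ) - ((k + 1 : ℕ) : ℝ) = ((k + 1 : ℕ) : ℝ) := by ring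
  have his' : (i : ℝ) ≤ ((k + 1 : ℕ) : ℝ) := by linarith
  simp only [hμ, hρ, hψ, hn1, hmin, hprod, hss, min_self, min_eq_left his']
  constructor
  · simpa using min_div_le_min_div hi his hm hms (c := 0) (by norm_num)
  · simpa only [div_eq_inv_mul _ (2 : ℝ)] using
      min_div_le_min_div (c := 2⁻¹) hi his hm hms (by norm_num)
end

section
/- Let n ≥ 4 be even, let i be an integer with 1 ≤ i ≤ ⌊n/4⌋, and set s = n/2 + 1. Define, for 1 ≤ j ≤ n, μ(j) = min(i, j, n+1−j), ρ̂(j) = j(n+1−j), and ψ̂(j) = j(n+1−j) − min(j, n+1−j)/2. Then for all 1 ≤ j ≤ n: μ(s)/ρ̂(s) ≤ μ(j)/ρ̂(j) and μ(s)/ψ̂(s) ≤ μ(j)/ψ̂(j). (That is, s is a minimizing index for both families of ratios.) -/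
/-- For `1 ≤ a ≤ m`, `0 < i ≤ m / 2` and `0 ≤ c ≤ 1`, the ratio `min i a / (a * (2 * m + c - a))`
is at least its value at `a = m`. -/
theorem div_le_min_div_mul_sub {m i a c : ℝ} (hi : 0 < i) (him : 2 * i ≤ m) (ha : 1 ≤ a)
    (ham : a ≤ m) (hc : 0 ≤ c) (hc1 : c ≤ 1) :
    i / (m * (m + c)) ≤ min i a / (a * (2 * m + c - a)) := by
  have hm : 0 < m * (m + c) := mul_pos (by linarith) (by linarith)
  have hd : 0 < a * (2 * m + c - a) := mul_pos (by linarith) (by linarith)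
  rw [div_le_div_iff₀ hm hd]
  rcases le_total i a with h | h
  · rw [min_eq_left h]
    refine mul_le_mul_of_nonneg_left ?_ hi.le
    nlinarith [sq_nonneg (m - a), mul_nonneg hc (sub_nonneg.2 ham)]
  · rw [min_eq_right h]
    have key : i * (2 * m + c - a) ≤ m * (m + c) := by
      nlinarith [mul_nonneg hi.le (by linarith : 0 ≤ a - c),
        mul_nonneg (by linarith : 0 ≤ m) (by linarith : 0 ≤ m - 2 * i),
        mul_nonneg (by linarith : 0 ≤ m) hc]
    nlinarith [mul_le_mul_of_nonneg_left key (by linarith : 0 ≤ a)]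


/-- For even `n ≥ 4` and `1 ≤ i ≤ ⌊n/4⌋`, with `s = n/2 + 1`,
`μ(j) = min(i, j, n+1−j)`, `ρ̂(j) = j(n+1−j)`, `ψ̂(j) = j(n+1−j) − min(j, n+1−j)/2`,
the index `s` minimizes both `μ(j)/ρ̂(j)` and `μ(j)/ψ̂(j)` over `1 ≤ j ≤ n`. -/
theorem stmt_10 (n i : ℕ) (hn : 4 ≤ n) (heven : Even n)
    (hi1 : 1 ≤ i) (hi2 : i ≤ n / 4)
    (s : ℕ) (hs : s = n / 2 + 1)
    (μ ρ ψ : ℕ → ℝ)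
    (hμ : ∀ j, μ j = min (i : ℝ) (min (j : ℝ) ((n : ℝ) + 1 - (j : ℝ))))
    (hρ : ∀ j, ρ j = (j : ℝ) * ((n : ℝ) + 1 - (j : ℝ)))
    (hψ : ∀ j, ψ j = (j : ℝ) * ((n : ℝ) + 1 - (j : ℝ)) - min (j : ℝ) ((n : ℝ) + 1 - (j : ℝ)) / 2) :
    ∀ j ∈ Finset.Icc 1 n, μ s / ρ s ≤ μ j / ρ j ∧ μ s / ψ s ≤ μ j / ψ j := by
  intro j hj
  obtain ⟨hj1, hjn⟩ := Finset.mem_Icc.1 hj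
  obtain ⟨m, rfl⟩ := heven
  obtain rfl : s = m + 1 := by omega
  have hi : (0 : ℝ) < i := by exact_mod_cast hi1
  have him : 2 * (i : ℝ) ≤ m := by exact_mod_cast (by omega : 2 * i ≤ m)
  have hsub : ((m + m : ℕ) : ℝ) + 1 - ((m + 1 : ℕ) : ℝ) = m := by push_cast; ring
  have hmin : min ((m + 1 : ℕ) : ℝ) (m : ℝ) = m := min_eq_right (by push_cast; linarith)
  have hμs : μ (m + 1) = i := by
    rw [hμ, hsub, hmin, min_eq_left (by linarith)]
  have hρs : ρ (m + 1) = m * (m + 1) := by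
    rw [hρ, hsub]; push_cast; ring
  have hψs : ψ (m + 1) = m * (m + 1 / 2) := by
    rw [hψ, hsub, hmin]; push_cast; ring
  obtain ⟨a, ha1, ham, hμj, hρj, hψj⟩ : ∃ a : ℝ, 1 ≤ a ∧ a ≤ m ∧ μ j = min (i : ℝ) a ∧
      ρ j = a * (2 * m + 1 - a) ∧ ψ j = a * (2 * m + 1 / 2 - a) := by
    have h1 : (1 : ℝ) ≤ j := by exact_mod_cast hj1
    have h2 : (j : ℝ) ≤ m + m := by exact_mod_cast hjn
    rcases le_or_gt j m with h | h
    · have h3 : (j : ℝ) ≤ m := by exact_mod_cast h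
      have h4 : min (j : ℝ) (((m + m : ℕ) : ℝ) + 1 - j) = j :=
        min_eq_left (by push_cast; linarith)
      refine ⟨j, h1, h3, by rw [hμ, h4], ?_, ?_⟩
      · rw [hρ]; push_cast; ring
      · rw [hψ, h4]; push_cast; ring
    · have h3 : (m : ℝ) + 1 ≤ j := by exact_mod_cast h
      have h4 : min (j : ℝ) (((m + m : ℕ) : ℝ) + 1 - j) = ((m + m : ℕ) : ℝ) + 1 - j :=
        min_eq_right (by push_cast; linarith)
      refine ⟨((m + m : ℕ) : ℝ) + 1 - j, by push_cast; linarith, by push_cast; linarith,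
        by rw [hμ, h4], ?_, ?_⟩
      · rw [hρ]; push_cast; ring
      · rw [hψ, h4]; push_cast; ring
  rw [hμs, hρs, hψs, hμj, hρj, hψj]
  exact ⟨div_le_min_div_mul_sub hi him ha1 ham zero_le_one le_rfl,
    div_le_min_div_mul_sub hi him ha1 ham (by norm_num) (by norm_num)⟩
end

section
/- Let n ≥ 2 and fix an integer i with 1 ≤ i ≤ n. Define, for 1 ≤ j ≤ n, ρ̂(j) = j(n+1−j) and ψ̂(j) = j(n+1−j) − min(j, n+1−j)/2. Let λ : {1,…,n} → ℝ satisfy λ(j) > 0 for all j and λ(i)/ψ̂(i) ≤ λ(j)/ψ̂(j) for all j. Then, setting m₁ = min_{1≤j≤n} λ(j)/ρ̂(j) and m₁′ = min_{1≤j≤n} λ(j)/ψ̂(j), one has m₁/m₁′ ≤ 1 − 1/(2·max(i, n+1−i)); equivalently, 2n(1 − m₁/m₁′) ≥ min(n/i, n/(n+1−i)). -/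
theorem mul_sub_min_div_two_eq {a b : ℝ} (h : max a b ≠ 0) :
    a * b - min a b / 2 = a * b * (1 - 1 / (2 * max a b)) := by
  rw [← min_mul_max a b]
  field_simp

theorem min_div_div_le_div_max {c a b : ℝ} : min (c / a) (c / b) ≤ c / max a b := by
  rcases max_choice a b with h | h <;> rw [h]
  · exact min_le_left _ _
  · exact min_le_right _ _


/-- Let `1 ≤ i ≤ n`, `ρ̂(j) = j(n+1−j)`, `ψ̂(j) = j(n+1−j) − min(j,n+1−j)/2`,
and let `λ` be positive with `i` a minimizing index of `λ/ψ̂`. Then with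
`m₁ = min_j λ(j)/ρ̂(j)` and `m₁′ = min_j λ(j)/ψ̂(j)` one has
`m₁/m₁′ ≤ 1 − 1/(2·max(i, n+1−i))`, equivalently `2n(1 − m₁/m₁′) ≥ min(n/i, n/(n+1−i))`. -/
theorem stmt_13 (n i : ℕ) (hn : 2 ≤ n) (hi1 : 1 ≤ i) (hi2 : i ≤ n)
    (hne : (Finset.Icc 1 n).Nonempty)
    (ρ ψ : ℕ → ℝ)
    (hρ : ∀ j, ρ j = (j : ℝ) * ((n : ℝ) + 1 - (j : ℝ)))
    (hψ : ∀ j, ψ j = (j : ℝ) * ((n : ℝ) + 1 - (j : ℝ)) - min (j : ℝ) ((n : ℝ) + 1 - (j : ℝ)) / 2)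
    (lam : ℕ → ℝ) (hlam : ∀ j ∈ Finset.Icc 1 n, 0 < lam j)
    (hmin : ∀ j ∈ Finset.Icc 1 n, lam i / ψ i ≤ lam j / ψ j)
    (m₁ m₁' : ℝ)
    (hm₁ : m₁ = (Finset.Icc 1 n).inf' hne fun j => lam j / ρ j)
    (hm₁' : m₁' = (Finset.Icc 1 n).inf' hne fun j => lam j / ψ j) :
    m₁ / m₁' ≤ 1 - 1 / (2 * max (i : ℝ) ((n : ℝ) + 1 - (i : ℝ))) ∧
      min ((n : ℝ) / (i : ℝ)) ((n : ℝ) / ((n : ℝ) + 1 - (i : ℝ))) ≤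
        2 * (n : ℝ) * (1 - m₁ / m₁') := by
  have hi : i ∈ Finset.Icc 1 n := Finset.mem_Icc.mpr ⟨hi1, hi2⟩
  have ha : (1 : ℝ) ≤ i := by exact_mod_cast hi1
  have hb : (1 : ℝ) ≤ (n : ℝ) + 1 - i := by
    have : (i : ℝ) ≤ n := by exact_mod_cast hi2
    linarith
  have hM : 1 ≤ max (i : ℝ) ((n : ℝ) + 1 - i) := le_max_of_le_left ha
  have hc : 0 < 1 - 1 / (2 * max (i : ℝ) ((n : ℝ) + 1 - i)) := by
    rw [sub_pos, div_lt_one (by linarith)]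
    linarith
  have hρi : 0 < ρ i := by
    rw [hρ]
    exact mul_pos (by linarith) (by linarith)
  have hψi : ψ i = ρ i * (1 - 1 / (2 * max (i : ℝ) ((n : ℝ) + 1 - i))) := by
    rw [hψ, hρ, mul_sub_min_div_two_eq (by linarith)]
  have hψpos : 0 < ψ i := hψi ▸ mul_pos hρi hc
  have hle : m₁ ≤ lam i / ρ i := hm₁ ▸ Finset.inf'_le (fun j => lam j / ρ j) hi
  have heq : m₁' = lam i / ψ i :=
    hm₁' ▸ le_antisymm (Finset.inf'_le (fun j => lam j / ψ j) hi) (Finset.le_inf' _ _ hmin)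
  have hratio : m₁ / m₁' ≤ 1 - 1 / (2 * max (i : ℝ) ((n : ℝ) + 1 - i)) := by
    rw [heq, div_le_iff₀ (div_pos (hlam i hi) hψpos)]
    refine hle.trans_eq ?_
    rw [hψi, mul_div_assoc', mul_comm (ρ i), mul_div_mul_left _ _ hc.ne']
  refine ⟨hratio, min_div_div_le_div_max.trans ?_⟩
  calc (n : ℝ) / max (i : ℝ) ((n : ℝ) + 1 - i)
      = 2 * n * (1 / (2 * max (i : ℝ) ((n : ℝ) + 1 - i))) := by field_simp
    _ ≤ 2 * n * (1 - m₁ / m₁') := by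
      gcongr
      linarith
end
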